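/- arXiv:2509.02510 — 4 statements merged into one kernel-verified Lean document; each statement's English description precedes it below -/
import Mathlib

section
/- For every subset S of {1,…,n} with Γ_S := Σ_{i∈S} p_i > 0, the Jensen–Shannon divergence between p and the truncated distribution q_S satisfies JSD(p‖q_S) = ln 2 + (1/2)·(Γ_S·ln Γ_S − (1+Γ_S)·ln(1+Γ_S)). In particular, JSD(p‖q_S) depends on S only through the total selected mass Γ_S. -/
/-- Kullback–Leibler divergence `KL(a‖b) = Σ_i a_i ln(a_i/b_i)`
(with the convention `0 · ln 0 = 0`, which holds automatically since
`Real.log 0 = 0` and multiplication by zero). -/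
noncomputable def KL {n : ℕ} (a b : Fin n → ℝ) : ℝ :=
  ∑ i, a i * Real.log (a i / b i)

/-- Jensen–Shannon divergence `JSD(a‖b) = ½ KL(a‖M) + ½ KL(b‖M)` with `M = (a+b)/2`. -/
noncomputable def JSD {n : ℕ} (a b : Fin n → ℝ) : ℝ :=
  (1 / 2) * KL a (fun i => (a i + b i) / 2) + (1 / 2) * KL b (fun i => (a i + b i) / 2)

/-- The truncation of `p` to a subset `S`: `q_S(i) = p_i / Γ_S` for `i ∈ S`, else `0`. -/
noncomputable def qtrunc {n : ℕ} (p : Fin n → ℝ) (S : Finset (Fin n)) : Fin n → ℝ :=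
  fun i => if i ∈ S then p i / ∑ j ∈ S, p j else 0

/-- The divergence of `p` from the midpoint of `p` and its truncation to `S`. -/
theorem KL_midpoint_qtrunc {n : ℕ} (p : Fin n → ℝ) (hp : ∀ i, 0 < p i)
    (hsum : ∑ i, p i = 1) (S : Finset (Fin n)) (hΓ : 0 < ∑ i ∈ S, p i) :
    KL p (fun i => (p i + qtrunc p S i) / 2) =
      Real.log 2 + (∑ i ∈ S, p i) *
        (Real.log (∑ i ∈ S, p i) - Real.log (1 + ∑ i ∈ S, p i)) := by
  have hterm : ∀ i, p i * Real.log (p i / ((p i + qtrunc p S i) / 2)) =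
      p i * Real.log 2 + if i ∈ S then
        p i * (Real.log (∑ j ∈ S, p j) - Real.log (1 + ∑ j ∈ S, p j)) else 0 := by
    intro i
    have hpi := hp i
    unfold qtrunc
    generalize (∑ j ∈ S, p j) = G at *
    split_ifs
    · have hratio : p i / ((p i + p i / G) / 2) = 2 * G / (1 + G) := by
        field_simp
        ring
      rw [hratio, Real.log_div (by positivity) (by positivity),
        Real.log_mul (by norm_num) hΓ.ne']
      ring
    · have hratio : p i / ((p i + 0) / 2) = 2 := by
        field_simp
        ring
      rw [hratio, add_zero]
  unfold KL
  simp only [hterm]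
  rw [Finset.sum_add_distrib, ← Finset.sum_mul, hsum, one_mul, Finset.sum_ite_mem,
    Finset.univ_inter, ← Finset.sum_mul]

/-- The divergence of the truncation of `p` to `S` from the midpoint of `p` and the truncation. -/
theorem KL_qtrunc_midpoint {n : ℕ} (p : Fin n → ℝ) (hp : ∀ i, 0 < p i)
    (S : Finset (Fin n)) (hΓ : 0 < ∑ i ∈ S, p i) :
    KL (qtrunc p S) (fun i => (p i + qtrunc p S i) / 2) =
      Real.log 2 - Real.log (1 + ∑ i ∈ S, p i) := by
  have hterm : ∀ i, qtrunc p S i * Real.log (qtrunc p S i / ((p i + qtrunc p S i) / 2)) =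
      if i ∈ S then
        p i * ((Real.log 2 - Real.log (1 + ∑ j ∈ S, p j)) / ∑ j ∈ S, p j) else 0 := by
    intro i
    have hpi := hp i
    unfold qtrunc
    generalize (∑ j ∈ S, p j) = G at *
    split_ifs
    · have hratio : p i / G / ((p i + p i / G) / 2) = 2 / (1 + G) := by
        field_simp
        ring
      rw [hratio, Real.log_div (by norm_num) (by positivity)]
      ring
    · rw [zero_mul]
  unfold KL
  simp only [hterm]
  rw [Finset.sum_ite_mem, Finset.univ_inter, ← Finset.sum_mul, mul_div_cancel₀ _ hΓ.ne']

/-- The Jensen–Shannon divergence between `p` and its truncation to `S`. -/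
theorem JSD_qtrunc {n : ℕ} (p : Fin n → ℝ) (hp : ∀ i, 0 < p i)
    (hsum : ∑ i, p i = 1) (S : Finset (Fin n)) (hΓ : 0 < ∑ i ∈ S, p i) :
    JSD p (qtrunc p S) =
      Real.log 2 + (1 / 2) * ((∑ i ∈ S, p i) * Real.log (∑ i ∈ S, p i) -
        (1 + ∑ i ∈ S, p i) * Real.log (1 + ∑ i ∈ S, p i)) := by
  unfold JSD
  rw [KL_midpoint_qtrunc p hp hsum S hΓ, KL_qtrunc_midpoint p hp S hΓ]
  ring

/-- For every subset `S` with `Γ_S := Σ_{i∈S} p_i > 0`,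
`JSD(p‖q_S) = ln 2 + ½ (Γ_S ln Γ_S − (1+Γ_S) ln(1+Γ_S))`; in particular the
Jensen–Shannon divergence depends on `S` only through `Γ_S`. -/
theorem jsd_trunc_formula {n : ℕ} (p : Fin n → ℝ) (hp : ∀ i, 0 < p i)
    (hsum : ∑ i, p i = 1) (S : Finset (Fin n)) (hΓ : 0 < ∑ i ∈ S, p i) :
    JSD p (qtrunc p S) =
      Real.log 2 + (1 / 2) * ((∑ i ∈ S, p i) * Real.log (∑ i ∈ S, p i) -
        (1 + ∑ i ∈ S, p i) * Real.log (1 + ∑ i ∈ S, p i)) ∧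
    ∀ S' : Finset (Fin n), (∑ i ∈ S', p i) = (∑ i ∈ S, p i) →
      JSD p (qtrunc p S') = JSD p (qtrunc p S) := by
  refine ⟨JSD_qtrunc p hp hsum S hΓ, fun S' hS' => ?_⟩
  rw [JSD_qtrunc p hp hsum S hΓ, JSD_qtrunc p hp hsum S' (hS' ▸ hΓ), hS']
end

section
/- For every j with 2 ≤ j ≤ n, the entropy increment of the greedy prefix distributions satisfies H(q^j) − H(q^{j−1}) ≥ ln(1 + p_j/Γ_{j−1}) > 0, where Γ_{j−1} = Σ_{i=1}^{j−1} p_i. In particular, each additional token strictly increases the entropy of the truncated distribution. -/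
/-- `Γ_j = Σ_{i=1}^{j} p_i` (1-based indexing). -/
noncomputable def Gam (p : ℕ → ℝ) (j : ℕ) : ℝ := ∑ i ∈ Finset.Icc 1 j, p i

/-- Shannon entropy `H(q^j)` of the truncated distribution `q^j(i) = p_i / Γ_j`
on the first `j` indices. -/
noncomputable def Hq (p : ℕ → ℝ) (j : ℕ) : ℝ :=
  -∑ i ∈ Finset.Icc 1 j, (p i / Gam p j) * Real.log (p i / Gam p j)

/-- The entropy of the truncated distribution, in unnormalised form. -/
theorem Hq_eq_log_sub (p : ℕ → ℝ) (j : ℕ) (hp : ∀ i ∈ Finset.Icc 1 j, 0 < p i)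
    (hG : 0 < Gam p j) :
    Hq p j = Real.log (Gam p j) - (∑ i ∈ Finset.Icc 1 j, p i * Real.log (p i)) / Gam p j := by
  have hterm : ∀ i ∈ Finset.Icc 1 j, p i / Gam p j * Real.log (p i / Gam p j) =
      p i * Real.log (p i) / Gam p j - p i * (Real.log (Gam p j) / Gam p j) := by
    intro i hi
    rw [Real.log_div (hp i hi).ne' hG.ne']
    ring
  rw [Hq, Finset.sum_congr rfl hterm, Finset.sum_sub_distrib, ← Finset.sum_div,
    ← Finset.sum_mul, show ∑ i ∈ Finset.Icc 1 j, p i = Gam p j from rfl, mul_div_cancel₀ _ hG.ne']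
  ring

theorem Gam_mul_log_le (p : ℕ → ℝ) (j : ℕ) {x : ℝ} (hx : 0 < x)
    (hp : ∀ i ∈ Finset.Icc 1 j, x ≤ p i) :
    Gam p j * Real.log x ≤ ∑ i ∈ Finset.Icc 1 j, p i * Real.log (p i) := by
  rw [Gam, Finset.sum_mul]
  exact Finset.sum_le_sum fun i hi =>
    mul_le_mul_of_nonneg_left (Real.log_le_log hx (hp i hi)) (hx.le.trans (hp i hi))

/-- For every `2 ≤ j ≤ n`, the entropy increment of the greedy prefix distributions
satisfies `H(q^j) − H(q^{j−1}) ≥ ln(1 + p_j/Γ_{j−1}) > 0`: each additional token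
strictly increases the entropy of the truncated distribution. -/
theorem entropy_increment_pos (n : ℕ) (p : ℕ → ℝ)
    (hpos : ∀ i, 1 ≤ i → i ≤ n → 0 < p i)
    (hdesc : ∀ i j, 1 ≤ i → i ≤ j → j ≤ n → p j ≤ p i)
    (hsum : ∑ i ∈ Finset.Icc 1 n, p i = 1)
    (j : ℕ) (hj2 : 2 ≤ j) (hjn : j ≤ n) :
    Real.log (1 + p j / Gam p (j - 1)) ≤ Hq p j - Hq p (j - 1) ∧
    0 < Real.log (1 + p j / Gam p (j - 1)) := by
  obtain ⟨k, rfl⟩ : ∃ k, j = k + 1 := ⟨j - 1, by lia⟩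
  rw [Nat.add_sub_cancel]
  have hp : ∀ i ∈ Finset.Icc 1 (k + 1), 0 < p i := fun i hi => by
    rw [Finset.mem_Icc] at hi
    exact hpos i hi.1 (by lia)
  have hp' : ∀ i ∈ Finset.Icc 1 k, 0 < p i := fun i hi =>
    hp i (Finset.Icc_subset_Icc_right k.le_succ hi)
  have hx : 0 < p (k + 1) := hpos _ (by lia) hjn
  have hS : 0 < Gam p k := Finset.sum_pos hp' ⟨1, Finset.mem_Icc.2 ⟨le_rfl, by lia⟩⟩
  have hG : Gam p (k + 1) = Gam p k + p (k + 1) := Finset.sum_Icc_succ_top (by lia) _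
  have hG0 : 0 < Gam p (k + 1) := by rw [hG]; positivity
  refine ⟨?_, Real.log_pos (by linarith [div_pos hx hS])⟩
  have hlog : Real.log (1 + p (k + 1) / Gam p k) =
      Real.log (Gam p (k + 1)) - Real.log (Gam p k) := by
    rw [← Real.log_div hG0.ne' hS.ne', hG, add_div, div_self hS.ne']
  have hL : Gam p k * Real.log (p (k + 1)) ≤ ∑ i ∈ Finset.Icc 1 k, p i * Real.log (p i) :=
    Gam_mul_log_le p k hx fun i hi => by
      rw [Finset.mem_Icc] at hi
      exact hdesc i (k + 1) hi.1 (by lia) hjn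
  have hdiv : (∑ i ∈ Finset.Icc 1 (k + 1), p i * Real.log (p i)) / Gam p (k + 1) ≤
      (∑ i ∈ Finset.Icc 1 k, p i * Real.log (p i)) / Gam p k := by
    rw [div_le_div_iff₀ hG0 hS, Finset.sum_Icc_succ_top (by lia), hG]
    linarith [mul_le_mul_of_nonneg_left hL hx.le]
  rw [Hq_eq_log_sub p _ hp hG0, Hq_eq_log_sub p _ hp' hS, hlog]
  linarith
end

section
/- Let w_1,…,w_m and τ be positive integers with w_i ≤ τ for every i, and let K be an integer with 3 ≤ K ≤ m. Define M = (K+1)·τ, w′_i = w_i + M, and τ′ = τ + K·M. Then: (i) for every subset S ⊆ {1,…,m} with |S| = K, Σ_{i∈S} w_i = τ if and only if Σ_{i∈S} w′_i = τ′; and (ii) the padded weights satisfy the narrow-range condition τ′/(K+1) < w′_i < τ′/(K−1) for every i. -/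
/-- Padding a cardinality-constrained subset-sum instance to the narrow range:
with `M = (K+1)τ`, `w′_i = w_i + M`, `τ′ = τ + K·M`, (i) a `K`-element subset
sums to `τ` iff it sums to `τ′` under the padded weights, and (ii) the padded
weights satisfy `τ′/(K+1) < w′_i < τ′/(K−1)` for every `i`. -/
theorem ccss_padding (m : ℕ) (w : Fin m → ℕ) (τ : ℕ)
    (hw : ∀ i, 0 < w i) (hτ : 0 < τ) (hwτ : ∀ i, w i ≤ τ)
    (K : ℕ) (hK3 : 3 ≤ K) (hKm : K ≤ m) :
    (∀ S : Finset (Fin m), S.card = K →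
      ((∑ i ∈ S, w i = τ) ↔
        (∑ i ∈ S, (w i + (K + 1) * τ) = τ + K * ((K + 1) * τ)))) ∧
    (∀ i : Fin m,
      ((τ + K * ((K + 1) * τ) : ℕ) : ℝ) / ((K : ℝ) + 1)
          < ((w i + (K + 1) * τ : ℕ) : ℝ) ∧
      ((w i + (K + 1) * τ : ℕ) : ℝ)
          < ((τ + K * ((K + 1) * τ) : ℕ) : ℝ) / ((K : ℝ) - 1)) := by
  refine ⟨fun S hS => ?_, fun i => ?_⟩
  · rw [Finset.sum_add_distrib, Finset.sum_const, hS, smul_eq_mul, Nat.add_right_cancel_iff]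
  · have hK : (3 : ℝ) ≤ K := by exact_mod_cast hK3
    have hτ' : (0 : ℝ) < τ := by exact_mod_cast hτ
    have hwi : (0 : ℝ) < w i := by exact_mod_cast hw i
    have hwi' : (w i : ℝ) ≤ τ := by exact_mod_cast hwτ i
    push_cast
    constructor
    · rw [div_lt_iff₀ (by linarith)]
      nlinarith [mul_pos hwi (by linarith : (0 : ℝ) < K + 1),
        mul_pos hτ' (by linarith : (0 : ℝ) < K)]
    · rw [lt_div_iff₀ (by linarith)]
      nlinarith [mul_le_mul_of_nonneg_right hwi' (by linarith : (0 : ℝ) ≤ K - 1)]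
end

section
/- Let K ≥ 20 and λ ≥ 2 be integers, and let B ≥ K^λ be an integer. Let q be a probability distribution whose atoms consist of b points each of probability exactly 1/(2B), with total booster mass δ := b/(2B) satisfying δ ≥ 1/K, together with finitely many further points each of probability strictly less than 1/(K−1) whose probabilities sum to 1 − δ. Then the Shannon entropy of q satisfies H(q) > ln K. -/
/-- An atom of probability at most `1 / M` contributes at least `x * log M` to the entropy. -/
theorem mul_log_le_neg_mul_log {x M : ℝ} (hx : 0 < x) (h : x ≤ 1 / M) :
    x * Real.log M ≤ -(x * Real.log x) := by
  have hlog : Real.log x ≤ -Real.log M := by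
    simpa using Real.log_le_log hx h
  nlinarith

/-- Replacing a fraction `1 / K` of a uniform law on `K - 1` points by much smaller atoms
raises the entropy above `log K`. -/
theorem log_lt_log_sub_one_add {K : ℝ} (hK : 20 ≤ K) :
    Real.log K < Real.log (K - 1) + 1 / K * Real.log (2 * K) := by
  have hK1 : 0 < K - 1 := by linarith
  have hratio : Real.log K - Real.log (K - 1) ≤ 1 / (K - 1) := by
    rw [← Real.log_div (by linarith) hK1.ne']
    have h := Real.log_le_sub_one_of_pos (show 0 < K / (K - 1) by positivity)
    have heq : K / (K - 1) - 1 = 1 / (K - 1) := by field_simp; ring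
    linarith
  have htwo : 2 < Real.log (2 * K) := by
    rw [Real.lt_log_iff_exp_lt (by linarith), show (2 : ℝ) = 1 + 1 by norm_num, Real.exp_add]
    nlinarith [Real.exp_one_lt_d9, Real.exp_pos 1]
  have hlt : 1 / (K - 1) < 1 / K * 2 := by
    rw [one_div_mul_eq_div, div_lt_div_iff₀ hK1 (by linarith)]
    linarith
  have hmul : 1 / K * 2 < 1 / K * Real.log (2 * K) := by gcongr
  linarith


/-- Booster blow-up: let `K ≥ 20`, `λ ≥ 2`, `B ≥ K^λ`. If `q` is a probability
distribution consisting of `b` booster atoms, each of probability exactly `1/(2B)`,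
of total booster mass `δ = b/(2B) ≥ 1/K`, together with finitely many heavy atoms,
each of probability strictly less than `1/(K−1)`, whose probabilities sum to `1 − δ`,
then `H(q) > ln K`. -/
theorem booster_blowup (K lam : ℕ) (hK : 20 ≤ K) (hlam : 2 ≤ lam)
    (B : ℕ) (hB : K ^ lam ≤ B) (b mh : ℕ)
    (q : Fin b ⊕ Fin mh → ℝ)
    (hbooster : ∀ i : Fin b, q (Sum.inl i) = 1 / (2 * (B : ℝ)))
    (hheavy : ∀ j : Fin mh, 0 < q (Sum.inr j) ∧ q (Sum.inr j) < 1 / ((K : ℝ) - 1))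
    (hδ : (1 : ℝ) / K ≤ (b : ℝ) / (2 * B))
    (hheavysum : ∑ j : Fin mh, q (Sum.inr j) = 1 - (b : ℝ) / (2 * B))
    (hsum : ∑ i, q i = 1) :
    Real.log K < -∑ i, q i * Real.log (q i) := by
  have hK' : (20 : ℝ) ≤ K := by exact_mod_cast hK
  have hB' : (K : ℝ) ^ 2 ≤ B := by
    exact_mod_cast (Nat.pow_le_pow_right (by omega) hlam).trans hB
  have hB0 : (0 : ℝ) < B := by nlinarith
  have hheavy_entropy : (1 - (b : ℝ) / (2 * B)) * Real.log (K - 1) ≤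
      -∑ j : Fin mh, q (Sum.inr j) * Real.log (q (Sum.inr j)) := by
    rw [← hheavysum, Finset.sum_mul, ← Finset.sum_neg_distrib]
    exact Finset.sum_le_sum fun j _ => mul_log_le_neg_mul_log (hheavy j).1 (hheavy j).2.le
  have hbooster_entropy : -∑ i : Fin b, q (Sum.inl i) * Real.log (q (Sum.inl i)) =
      (b : ℝ) / (2 * B) * Real.log (2 * B) := by
    simp only [hbooster, Finset.sum_const, Finset.card_univ, Fintype.card_fin, nsmul_eq_mul,
      one_div, Real.log_inv]
    ring
  have hgap : Real.log (K - 1) + Real.log (2 * K) ≤ Real.log (2 * B) := by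
    rw [← Real.log_mul (by linarith) (by linarith)]
    exact Real.log_le_log (by nlinarith) (by nlinarith)
  have hlog0 : 0 ≤ Real.log (2 * K) := Real.log_nonneg (by linarith)
  have hmul : 1 / (K : ℝ) * Real.log (2 * K) ≤
      (b : ℝ) / (2 * B) * (Real.log (2 * B) - Real.log (K - 1)) :=
    mul_le_mul hδ (by linarith) hlog0 (by positivity)
  rw [Fintype.sum_sum_type, neg_add, hbooster_entropy]
  linarith [log_lt_log_sub_one_add hK']
end
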